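/- Let p₁(·), p₂(·) : ℝⁿ → [1,∞) be measurable exponent functions, define p(·) by 1/p(x) = 1/p₁(x) + 1/p₂(x), and let w₁, w₂ be weights with w = w₁w₂. Then (w₁,w₂,w) ∈ A_{p⃗(·)} if and only if there is a constant C such that for every cube Q, ‖A_Q(f₁,f₂)w‖_{p(·)} ≤ C‖f₁w₁‖_{p₁(·)}‖f₂w₂‖_{p₂(·)} for all f₁, f₂, where A_Q(f₁,f₂)(x) = (⨍_Q f₁ dy)(⨍_Q f₂ dy)χ_Q(x) is the bilinear averaging operator over Q. No log-Hölder continuity is assumed. -/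

import Mathlib

open MeasureTheory ENNReal Set

noncomputable section

/-- Euclidean space `ℝⁿ`. -/
abbrev Rn (n : ℕ) : Type := Fin n → ℝ

/-- A cube in `ℝⁿ` with sides parallel to the coordinate axes. -/
structure Cube (n : ℕ) : Type where
  base : Fin n → ℝ
  side : ℝ
  side_pos : 0 < side

namespace Cube

/-- The set of points of a cube. -/
def toSet {n : ℕ} (Q : Cube n) : Set (Rn n) :=
  {x | ∀ i, Q.base i ≤ x i ∧ x i < Q.base i + Q.side}

/-- The volume `|Q|` of a cube. -/
def vol {n : ℕ} (Q : Cube n) : ℝ≥0∞ := ENNReal.ofReal (Q.side ^ n)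

/-- Membership in the standard dyadic grid `𝒟₀`. -/
def IsDyadic {n : ℕ} (Q : Cube n) : Prop :=
  ∃ (k : ℤ) (j : Fin n → ℤ), Q.side = (2 : ℝ) ^ (-k) ∧
    ∀ i, Q.base i = (2 : ℝ) ^ (-k) * (j i : ℝ)

end Cube

/-- The modular associated to an extended-real-valued exponent `r(·)`:
`ρ(f/λ) = ∫_{r ≠ ∞} (f/λ)^{r(x)} dμ + ‖f/λ‖_{L^∞({r = ∞})}`. -/
def eModular {n : ℕ} (r : Rn n → ℝ≥0∞) (μ : Measure (Rn n)) (f : Rn n → ℝ≥0∞)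
    (lam : ℝ≥0∞) : ℝ≥0∞ :=
  (∫⁻ x in {x | r x ≠ ∞}, (f x / lam) ^ (r x).toReal ∂μ)
    + essSup (fun x => f x / lam) (μ.restrict {x | r x = ∞})

/-- The variable Lebesgue (quasi)norm `‖f‖_{r(·)}` with respect to a measure `μ`. -/
def eNorm {n : ℕ} (r : Rn n → ℝ≥0∞) (μ : Measure (Rn n)) (f : Rn n → ℝ≥0∞) : ℝ≥0∞ :=
  sInf {lam : ℝ≥0∞ | lam ≠ 0 ∧ eModular r μ f lam ≤ 1}

/-- The variable Lebesgue norm of a real-valued function with respect to Lebesgue measure. -/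
def vNorm {n : ℕ} (r : Rn n → ℝ≥0∞) (f : Rn n → ℝ) : ℝ≥0∞ :=
  eNorm r volume fun x => ENNReal.ofReal |f x|

/-- View a real-valued exponent as an extended-real-valued one. -/
def ofExp {n : ℕ} (p : Rn n → ℝ) : Rn n → ℝ≥0∞ := fun x => ENNReal.ofReal (p x)

/-- The conjugate of an extended real exponent: `1/t + 1/t' = 1`. -/
def econj (t : ℝ≥0∞) : ℝ≥0∞ :=
  if t = 1 then ∞ else if t = ∞ then 1 else ENNReal.ofReal (t.toReal / (t.toReal - 1))

/-- The pointwise conjugate exponent `p'(·)` of a real-valued exponent. -/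
def conjExp {n : ℕ} (p : Rn n → ℝ) : Rn n → ℝ≥0∞ := fun x => econj (ENNReal.ofReal (p x))

/-- A weight: a measurable function that is positive (and finite) a.e. -/
def IsWeight {n : ℕ} (w : Rn n → ℝ) : Prop :=
  Measurable w ∧ ∀ᵐ x ∂(volume : Measure (Rn n)), 0 < w x

/-- Local log-Hölder continuity `LH₀`. -/
def LH0 {n : ℕ} (p : Rn n → ℝ) : Prop :=
  ∃ C₀ > 0, ∀ x y : Rn n, dist x y < 1 / 2 →
    |1 / p x - 1 / p y| ≤ C₀ / (-Real.log (dist x y))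

/-- Log-Hölder continuity at infinity with a given asymptotic value `pinf`. -/
def LHinfWith {n : ℕ} (p : Rn n → ℝ) (pinf : ℝ) : Prop :=
  ∃ C > 0, ∀ x : Rn n, |1 / p x - 1 / pinf| ≤ C / Real.log (Real.exp 1 + ‖x‖)

/-- Log-Hölder continuity at infinity `LH∞`. -/
def LHinf {n : ℕ} (p : Rn n → ℝ) : Prop := ∃ pinf > 0, LHinfWith p pinf

/-- Log-Hölder continuity `LH = LH₀ ∩ LH∞`. -/
def LH {n : ℕ} (p : Rn n → ℝ) : Prop := LH0 p ∧ LHinf p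

/-- The bilinear variable Muckenhoupt condition `(w₁,w₂,w) ∈ A_{p⃗(·)}`. -/
def ApVec {n : ℕ} (p₁ p₂ p w₁ w₂ w : Rn n → ℝ) : Prop :=
  ∃ C : ℝ≥0∞, C ≠ ∞ ∧ ∀ Q : Cube n,
    Q.vol⁻¹ ^ 2 * vNorm (ofExp p) (Q.toSet.indicator w) *
      vNorm (conjExp p₁) (Q.toSet.indicator fun x => (w₁ x)⁻¹) *
      vNorm (conjExp p₂) (Q.toSet.indicator fun x => (w₂ x)⁻¹) ≤ C

/-- The variable Muckenhoupt class `A_{r(·)}` for an extended-real-valued exponent. -/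
def ApVarE {n : ℕ} (r : Rn n → ℝ≥0∞) (v : Rn n → ℝ) : Prop :=
  ∃ C : ℝ≥0∞, C ≠ ∞ ∧ ∀ Q : Cube n,
    Q.vol⁻¹ * vNorm r (Q.toSet.indicator v) *
      vNorm (fun x => econj (r x)) (Q.toSet.indicator fun x => (v x)⁻¹) ≤ C

/-- The bilinear maximal operator `M(f₁,f₂)`. -/
def biMax {n : ℕ} (f₁ f₂ : Rn n → ℝ) (x : Rn n) : ℝ≥0∞ :=
  ⨆ (Q : Cube n) (_ : x ∈ Q.toSet),
    (Q.vol⁻¹ * ∫⁻ y in Q.toSet, ENNReal.ofReal |f₁ y|) *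
      (Q.vol⁻¹ * ∫⁻ y in Q.toSet, ENNReal.ofReal |f₂ y|)

/-- The dyadic bilinear maximal operator `M^d(f₁,f₂)`. -/
def biMaxD {n : ℕ} (f₁ f₂ : Rn n → ℝ) (x : Rn n) : ℝ≥0∞ :=
  ⨆ (Q : Cube n) (_ : Q.IsDyadic) (_ : x ∈ Q.toSet),
    (Q.vol⁻¹ * ∫⁻ y in Q.toSet, ENNReal.ofReal |f₁ y|) *
      (Q.vol⁻¹ * ∫⁻ y in Q.toSet, ENNReal.ofReal |f₂ y|)

/-- The bilinear averaging operator `A_Q(f₁,f₂) = (⨍_Q f₁)(⨍_Q f₂)χ_Q`. -/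
def avgOp {n : ℕ} (Q : Cube n) (f₁ f₂ : Rn n → ℝ) (x : Rn n) : ℝ≥0∞ :=
  Q.toSet.indicator
    (fun _ =>
      (Q.vol⁻¹ * ∫⁻ y in Q.toSet, ENNReal.ofReal |f₁ y|) *
        (Q.vol⁻¹ * ∫⁻ y in Q.toSet, ENNReal.ofReal |f₂ y|)) x

/-- `(p)₋(Q)`, the essential infimum of `p` on a cube `Q`. -/
def pMinusOn {n : ℕ} (p : Rn n → ℝ) (Q : Cube n) : ℝ :=
  essInf p (volume.restrict Q.toSet)

/-- The exponent `q(Q)` with `1/q(Q) = 1/(p₁)₋(Q) + 1/(p₂)₋(Q)`. -/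
def qExp {n : ℕ} (p₁ p₂ : Rn n → ℝ) (Q : Cube n) : ℝ :=
  ((pMinusOn p₁ Q)⁻¹ + (pMinusOn p₂ Q)⁻¹)⁻¹

theorem eModular_mono {n : ℕ} {r : Rn n → ℝ≥0∞} {μ : Measure (Rn n)} {f g : Rn n → ℝ≥0∞}
    (h : f ≤ᵐ[μ] g) {a b : ℝ≥0∞} (hab : b ≤ a) :
    eModular r μ f a ≤ eModular r μ g b := by
  refine add_le_add (lintegral_mono_ae ?_) (essSup_mono_ae ?_)
  · filter_upwards [ae_restrict_of_ae h] with x hx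
    gcongr
  · filter_upwards [ae_restrict_of_ae h] with x hx
    gcongr

theorem eNorm_mono_ae {n : ℕ} {r : Rn n → ℝ≥0∞} {μ : Measure (Rn n)} {f g : Rn n → ℝ≥0∞}
    (h : f ≤ᵐ[μ] g) : eNorm r μ f ≤ eNorm r μ g :=
  sInf_le_sInf fun _ hl => ⟨hl.1, (eModular_mono h le_rfl).trans hl.2⟩

theorem eModular_le_one_of_eNorm_lt {n : ℕ} {r : Rn n → ℝ≥0∞} {μ : Measure (Rn n)}
    {f : Rn n → ℝ≥0∞} {a : ℝ≥0∞} (h : eNorm r μ f < a) : eModular r μ f a ≤ 1 := by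
  obtain ⟨b, hb, hba⟩ := sInf_lt_iff.1 h
  exact (eModular_mono (Filter.EventuallyLE.refl _ f) hba.le).trans hb.2

theorem eNorm_const_mul_le {n : ℕ} (r : Rn n → ℝ≥0∞) (μ : Measure (Rn n))
    (f : Rn n → ℝ≥0∞) {c : ℝ≥0∞} (hc0 : c ≠ 0) (hc : c ≠ ∞) :
    eNorm r μ (fun x => c * f x) ≤ c * eNorm r μ f := by
  rw [← ENNReal.div_le_iff' hc0 hc]
  refine le_sInf fun l hl => ?_
  rw [ENNReal.div_le_iff' hc0 hc]
  refine sInf_le ⟨mul_ne_zero hc0 hl.1, ?_⟩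
  have : eModular r μ (fun x => c * f x) (c * l) = eModular r μ f l := by
    simp only [eModular, ENNReal.mul_div_mul_left _ _ hc0 hc]
  exact this.trans_le hl.2

theorem le_eNorm_const_mul {n : ℕ} (r : Rn n → ℝ≥0∞) (μ : Measure (Rn n))
    (f : Rn n → ℝ≥0∞) {c : ℝ≥0∞} (hc0 : c ≠ 0) (hc : c ≠ ∞) :
    c * eNorm r μ f ≤ eNorm r μ (fun x => c * f x) := by
  have h := eNorm_const_mul_le r μ (fun x => c * f x)
    (ENNReal.inv_ne_zero.2 hc) (ENNReal.inv_ne_top.2 hc0)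
  simp only [← mul_assoc, ENNReal.inv_mul_cancel hc0 hc, one_mul] at h
  calc c * eNorm r μ f ≤ c * (c⁻¹ * eNorm r μ (fun x => c * f x)) := by gcongr
    _ = _ := by rw [← mul_assoc, ENNReal.mul_inv_cancel hc0 hc, one_mul]

/-- Homogeneity, allowing an infinite or a zero factor. -/
theorem eNorm_const_mul_le_of_ne {n : ℕ} (r : Rn n → ℝ≥0∞) (μ : Measure (Rn n))
    (f : Rn n → ℝ≥0∞) (c : ℝ≥0∞) (h0 : eNorm r μ f ≠ 0) (ht : eNorm r μ f ≠ ∞) :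
    eNorm r μ (fun x => c * f x) ≤ c * eNorm r μ f := by
  refine ENNReal.le_mul_of_forall_lt (Or.inr ht) (Or.inr h0) fun c' hc' b hb => ?_
  rcases eq_or_ne c' ∞ with rfl | hct
  · rw [ENNReal.top_mul hb.ne_bot]
    exact le_top
  · calc eNorm r μ (fun x => c * f x) ≤ eNorm r μ (fun x => c' * f x) :=
          eNorm_mono_ae (Filter.Eventually.of_forall fun x => by dsimp only; gcongr)
      _ ≤ c' * eNorm r μ f := eNorm_const_mul_le r μ f hc'.ne_bot hct
      _ ≤ c' * b := by gcongr

theorem ae_eq_zero_of_eNorm_eq_zero {n : ℕ} {r : Rn n → ℝ≥0∞} {μ : Measure (Rn n)}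
    {f : Rn n → ℝ≥0∞} (hr : Measurable r) (hr0 : ∀ x, r x ≠ 0) (hf : Measurable f)
    (h : eNorm r μ f = 0) : ∀ᵐ x ∂μ, f x = 0 := by
  have key : ∀ k : ℕ, eModular r μ f (k + 1 : ℝ≥0∞)⁻¹ ≤ 1 := fun k =>
    eModular_le_one_of_eNorm_lt (by rw [h]; simp)
  have hm : MeasurableSet {x | r x ≠ ∞} := hr (measurableSet_singleton ∞).compl
  have hm' : MeasurableSet {x | r x = ∞} := hr (measurableSet_singleton ∞)
  have hfin : ∀ᵐ x ∂μ, x ∈ {x | r x ≠ ∞} → f x = 0 := by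
    rw [← ae_restrict_iff' hm]
    have hsup : ∫⁻ x in {x | r x ≠ ∞}, ⨆ k : ℕ, (f x / (k + 1 : ℝ≥0∞)⁻¹) ^ (r x).toReal ∂μ
        ≤ 1 := by
      rw [lintegral_iSup]
      · exact iSup_le fun k => le_self_add.trans (key k)
      · intro k
        exact (hf.div_const _).pow hr.ennreal_toReal
      · intro k l hkl x
        dsimp only
        gcongr
    have hae := ae_lt_top' (by
      refine (Measurable.iSup fun k : ℕ => ?_).aemeasurable
      exact (hf.div_const _).pow hr.ennreal_toReal) (hsup.trans_lt one_lt_top).ne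
    filter_upwards [hae, ae_restrict_mem hm] with x hx hxr
    by_contra hfx
    have hpos : 0 < (r x).toReal := ENNReal.toReal_pos (hr0 x) hxr
    obtain ⟨k, hk⟩ := ENNReal.exists_nat_mul_gt hfx
      (ENNReal.rpow_lt_top_of_nonneg (inv_nonneg.2 hpos.le) hx.ne).ne
    have h1 := le_iSup (fun k : ℕ => (f x / (k + 1 : ℝ≥0∞)⁻¹) ^ (r x).toReal) k
    rw [← ENNReal.le_rpow_inv_iff hpos] at h1
    refine absurd (hk.trans_le ?_) (not_lt.2 h1)
    rw [div_eq_mul_inv, inv_inv, mul_comm]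
    gcongr
    exact le_self_add
  have hinf : ∀ᵐ x ∂μ, x ∈ {x | r x = ∞} → f x = 0 := by
    rw [← ae_restrict_iff' hm']
    have hall : ∀ᵐ x ∂(μ.restrict {x | r x = ∞}), ∀ k : ℕ, f x / (k + 1 : ℝ≥0∞)⁻¹ ≤ 1 := by
      rw [ae_all_iff]
      intro k
      filter_upwards [ENNReal.ae_le_essSup (μ := μ.restrict {x | r x = ∞})
        (fun x => f x / (k + 1 : ℝ≥0∞)⁻¹)] with x hx
      exact hx.trans (le_add_self.trans (key k))
    filter_upwards [hall] with x hx
    by_contra hfx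
    obtain ⟨k, hk⟩ := ENNReal.exists_nat_mul_gt hfx one_ne_top
    refine absurd (hk.trans_le ?_) (not_lt.2 (hx k))
    rw [div_eq_mul_inv, inv_inv, mul_comm]
    gcongr
    exact le_self_add
  filter_upwards [hfin, hinf] with x h1 h2
  by_cases hx : r x = ∞
  · exact h2 hx
  · exact h1 hx

theorem conjExp_of_eq_one {n : ℕ} {p : Rn n → ℝ} {x : Rn n} (h : p x = 1) :
    conjExp p x = ∞ := by
  simp [conjExp, econj, h]

theorem conjExp_of_one_lt {n : ℕ} {p : Rn n → ℝ} {x : Rn n} (h : 1 < p x) :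
    conjExp p x = ENNReal.ofReal (p x).conjExponent := by
  have h1 : ENNReal.ofReal (p x) ≠ 1 := by
    rw [Ne, ENNReal.ofReal_eq_one]
    exact h.ne'
  simp [conjExp, econj, h1, Real.conjExponent, ENNReal.toReal_ofReal (zero_le_one.trans h.le)]

theorem conjExp_eq_top_iff {n : ℕ} {p : Rn n → ℝ} (hp : ∀ x, 1 ≤ p x) (x : Rn n) :
    conjExp p x = ∞ ↔ p x = 1 := by
  refine ⟨fun h => ?_, conjExp_of_eq_one⟩
  by_contra hne
  rw [conjExp_of_one_lt (lt_of_le_of_ne (hp x) (Ne.symm hne))] at h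
  exact ENNReal.ofReal_ne_top h

theorem toReal_conjExp {n : ℕ} {p : Rn n → ℝ} {x : Rn n} (h : 1 < p x) :
    (conjExp p x).toReal = (p x).conjExponent := by
  rw [conjExp_of_one_lt h, ENNReal.toReal_ofReal (Real.HolderConjugate.conjExponent h).symm.nonneg]

theorem conjExp_ne_zero {n : ℕ} {p : Rn n → ℝ} (hp : ∀ x, 1 ≤ p x) (x : Rn n) :
    conjExp p x ≠ 0 := by
  rcases (hp x).eq_or_lt with h | h
  · simp [conjExp_of_eq_one h.symm]
  · rw [conjExp_of_one_lt h]
    simpa using (Real.HolderConjugate.conjExponent h).symm.pos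

theorem measurable_conjExp {n : ℕ} {p : Rn n → ℝ} (hp : Measurable p) :
    Measurable (conjExp p) := by
  have h : Measurable econj :=
    Measurable.ite (measurableSet_singleton _) measurable_const
      (Measurable.ite (measurableSet_singleton _) measurable_const (by fun_prop))
  exact h.comp hp.ennreal_ofReal

theorem eModular_ofExp {n : ℕ} {p : Rn n → ℝ} (hp : ∀ x, 0 ≤ p x) (μ : Measure (Rn n))
    (f : Rn n → ℝ≥0∞) (l : ℝ≥0∞) :
    eModular (ofExp p) μ f l = ∫⁻ x, (f x / l) ^ p x ∂μ := by
  simp [eModular, ofExp, ENNReal.toReal_ofReal (hp _)]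

/-- Hölder's inequality for variable exponents. -/
theorem lintegral_mul_le_eNorm_mul_eNorm {n : ℕ} {p : Rn n → ℝ} (hpm : Measurable p)
    (hp : ∀ x, 1 ≤ p x) {μ : Measure (Rn n)} {f g : Rn n → ℝ≥0∞} (hf : Measurable f)
    (hg : Measurable g) (hg0 : eNorm (conjExp p) μ g ≠ 0) (hgt : eNorm (conjExp p) μ g ≠ ∞) :
    ∫⁻ x, f x * g x ∂μ ≤ 2 * (eNorm (ofExp p) μ f * eNorm (conjExp p) μ g) := by
  rw [← ENNReal.div_le_iff' two_ne_zero ofNat_ne_top]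
  refine ENNReal.le_mul_of_forall_lt (Or.inr hgt) (Or.inr hg0) fun a ha b hb => ?_
  rw [ENNReal.div_le_iff' two_ne_zero ofNat_ne_top]
  rcases eq_or_ne a ∞ with rfl | hat
  · simp [ENNReal.top_mul hb.ne_bot]
  rcases eq_or_ne b ∞ with rfl | hbt
  · simp [ENNReal.mul_top ha.ne_bot]
  have ha0 : a ≠ 0 := ha.ne_bot
  have hb0 : b ≠ 0 := hb.ne_bot
  have hfa := eModular_le_one_of_eNorm_lt ha
  have hgb := eModular_le_one_of_eNorm_lt hb
  rw [eModular_ofExp fun x => zero_le_one.trans (hp x)] at hfa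
  have hqm := measurable_conjExp hpm
  have hm : MeasurableSet {x | conjExp p x ≠ ∞} := hqm (measurableSet_singleton ∞).compl
  have hm' : MeasurableSet {x | conjExp p x = ∞} := hqm (measurableSet_singleton ∞)
  have hpt : ∀ᵐ x ∂μ, f x * g x ≤ a * b * ((f x / a) ^ p x +
      {x | conjExp p x ≠ ∞}.indicator (fun x => (g x / b) ^ (conjExp p x).toReal) x) := by
    have he := ENNReal.ae_le_essSup (μ := μ.restrict {x | conjExp p x = ∞}) (fun x => g x / b)
    rw [ae_restrict_iff' hm'] at he
    filter_upwards [he] with x hx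
    have hfg : f x * g x = a * b * (f x / a * (g x / b)) := by
      calc f x * g x = (a * (f x / a)) * (b * (g x / b)) := by
            rw [ENNReal.mul_div_cancel ha0 hat, ENNReal.mul_div_cancel hb0 hbt]
        _ = _ := by ring
    rw [hfg]
    gcongr
    rcases (hp x).eq_or_lt with h | h
    · have hg1 : g x / b ≤ 1 := (hx (conjExp_of_eq_one h.symm)).trans (le_add_self.trans hgb)
      rw [← h, ENNReal.rpow_one]
      exact (mul_le_of_le_one_right' hg1).trans le_self_add
    · have hmem : x ∈ {x | conjExp p x ≠ ∞} := by
        simp [conjExp_of_one_lt h]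
      rw [indicator_of_mem hmem, toReal_conjExp h]
      have hc := Real.HolderConjugate.conjExponent h
      refine (ENNReal.young_inequality _ _ hc).trans (add_le_add ?_ ?_)
      · exact ENNReal.div_le_of_le_mul (le_mul_of_one_le_right' (by simpa using h.le))
      · exact ENNReal.div_le_of_le_mul (le_mul_of_one_le_right' (by simpa using hc.symm.lt.le))
  calc ∫⁻ x, f x * g x ∂μ ≤ ∫⁻ x, a * b * ((f x / a) ^ p x +
      {x | conjExp p x ≠ ∞}.indicator (fun x => (g x / b) ^ (conjExp p x).toReal) x) ∂μ :=
        lintegral_mono_ae hpt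
    _ = a * b * (∫⁻ x, (f x / a) ^ p x ∂μ +
        ∫⁻ x in {x | conjExp p x ≠ ∞}, (g x / b) ^ (conjExp p x).toReal ∂μ) := by
      have hm1 : Measurable fun x => (f x / a) ^ p x := (hf.div_const _).pow hpm
      have hm2 : Measurable fun x => (g x / b) ^ (conjExp p x).toReal :=
        (hg.div_const _).pow hqm.ennreal_toReal
      rw [lintegral_const_mul _ (by exact hm1.add (hm2.indicator hm)), lintegral_add_left hm1,
        lintegral_indicator hm]
    _ ≤ a * b * (1 + 1) := by
      gcongr
      exact le_self_add.trans hgb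
    _ = 2 * (a * b) := by ring

/-- Norm conjugate inequality: a norm below `eNorm (conjExp p) μ g` is attained, up to a
factor `3`, by pairing `g` with a function in the unit ball of `L^{p(·)}`. -/
theorem exists_le_lintegral_mul {n : ℕ} {p : Rn n → ℝ} (hpm : Measurable p)
    (hp : ∀ x, 1 ≤ p x) {μ : Measure (Rn n)} [SigmaFinite μ] {g : Rn n → ℝ≥0∞}
    (hg : Measurable g) (hgt : ∀ x, g x ≠ ∞) {b : ℝ≥0∞} (hb : b < eNorm (conjExp p) μ g) :
    ∃ h : Rn n → ℝ≥0∞, Measurable h ∧ (∀ x, h x ≠ ∞) ∧ eNorm (ofExp p) μ h ≤ 1 ∧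
      b ≤ 3 * ∫⁻ x, h x * g x ∂μ := by
  have hp0 : ∀ x, 0 ≤ p x := fun x => zero_le_one.trans (hp x)
  have of_integral : ∀ h : Rn n → ℝ≥0∞, ∫⁻ x, h x ^ p x ∂μ ≤ 1 → eNorm (ofExp p) μ h ≤ 1 :=
    fun h hh => sInf_le ⟨one_ne_zero, by rw [eModular_ofExp hp0]; simpa using hh⟩
  rcases eq_or_ne b 0 with rfl | hb0
  · refine ⟨0, measurable_zero, by simp, of_integral _ ?_, zero_le⟩
    simp [ENNReal.zero_rpow_of_pos (zero_lt_one.trans_le (hp _))]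
  have hbt : b ≠ ∞ := hb.ne_top
  have hqm := measurable_conjExp hpm
  have hm : MeasurableSet {x | conjExp p x ≠ ∞} := hqm (measurableSet_singleton ∞).compl
  have hm' : MeasurableSet {x | conjExp p x = ∞} := hqm (measurableSet_singleton ∞)
  have hmod : 1 < eModular (conjExp p) μ g b := by
    by_contra hcon
    exact absurd (show eNorm (conjExp p) μ g ≤ b from sInf_le ⟨hb0, not_lt.1 hcon⟩) (not_le.2 hb)
  have hgb : ∀ x, g x / b ≠ ∞ := fun x => ENNReal.div_ne_top (hgt x) hb0
  have hgbm : Measurable fun x => g x / b := hg.div_const b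
  have hcases : 2⁻¹ < ∫⁻ x in {x | conjExp p x ≠ ∞}, (g x / b) ^ (conjExp p x).toReal ∂μ ∨
      2⁻¹ < essSup (fun x => g x / b) (μ.restrict {x | conjExp p x = ∞}) := by
    by_contra! hcon
    refine absurd (add_le_add hcon.1 hcon.2) (not_le.2 ?_)
    rw [ENNReal.inv_two_add_inv_two]
    exact hmod
  rcases hcases with hI | hE
  · set G := {x | conjExp p x ≠ ∞}
    set F : Rn n → ℝ≥0∞ := G.indicator fun x => (g x / b) ^ (conjExp p x).toReal with hF
    have hFm : Measurable F := (hgbm.pow hqm.ennreal_toReal).indicator hm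
    have hFt : ∀ x, F x ≠ ∞ := by
      intro x
      by_cases hx : x ∈ G
      · rw [hF, indicator_of_mem hx]
        exact ENNReal.rpow_ne_top_of_nonneg toReal_nonneg (hgb x)
      · rw [hF, indicator_of_notMem hx]
        exact zero_ne_top
    have : SigmaFinite (μ.withDensity F) :=
      SigmaFinite.withDensity_of_ne_top (Filter.Eventually.of_forall hFt)
    have hν : 2⁻¹ < μ.withDensity F univ := by
      rwa [withDensity_apply _ MeasurableSet.univ, Measure.restrict_univ, lintegral_indicator hm]
    obtain ⟨S, hSm, -, hS, hSt⟩ := Measure.exists_subset_measure_lt_top MeasurableSet.univ hν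
    rw [withDensity_apply _ hSm, ← lintegral_indicator hSm] at hS hSt
    set I := ∫⁻ x, S.indicator F x ∂μ
    have hSF : Measurable (S.indicator F) := hFm.indicator hSm
    have ht1 : (1 + I)⁻¹ ≤ 1 := ENNReal.inv_le_one.2 le_self_add
    have h1I0 : 1 + I ≠ 0 := (zero_lt_one.trans_le le_self_add).ne'
    have h1It : 1 + I ≠ ∞ := ENNReal.add_ne_top.2 ⟨one_ne_top, hSt.ne⟩
    have htt : (1 + I)⁻¹ ≠ ∞ := ne_top_of_le_ne_top one_ne_top ht1
    have hone : ∀ x ∈ G, 1 < p x := fun x hx =>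
      lt_of_le_of_ne (hp x) fun h => hx (conjExp_of_eq_one h.symm)
    refine ⟨(S ∩ G).indicator fun x => (1 + I)⁻¹ * (g x / b) ^ ((conjExp p x).toReal - 1),
      ((hgbm.pow (hqm.ennreal_toReal.sub_const 1)).const_mul _).indicator (hSm.inter hm),
      ?_, of_integral _ ?_, ?_⟩
    · intro x
      by_cases hx : x ∈ S ∩ G
      · rw [indicator_of_mem hx, toReal_conjExp (hone x hx.2)]
        refine ENNReal.mul_ne_top htt (ENNReal.rpow_ne_top_of_nonneg ?_ (hgb x))
        exact (Real.HolderConjugate.conjExponent (hone x hx.2)).symm.sub_one_pos.le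
      · simp [indicator_of_notMem hx]
    · calc _ ≤ ∫⁻ x, (1 + I)⁻¹ * S.indicator F x ∂μ := by
            refine lintegral_mono fun x => ?_
            by_cases hx : x ∈ S ∩ G
            · have hc := Real.HolderConjugate.conjExponent (hone x hx.2)
              rw [indicator_of_mem hx, indicator_of_mem hx.1, hF, indicator_of_mem hx.2,
                toReal_conjExp (hone x hx.2), ENNReal.mul_rpow_of_nonneg _ _ (hp0 x),
                ← ENNReal.rpow_mul]
              have hexp : ((p x).conjExponent - 1) * p x = (p x).conjExponent := by
                have := hc.mul_eq_add
                linarith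
              rw [hexp]
              gcongr
              calc ((1 + I)⁻¹) ^ p x ≤ ((1 + I)⁻¹) ^ (1 : ℝ) :=
                    ENNReal.rpow_le_rpow_of_exponent_ge ht1 (hp x)
                _ = _ := ENNReal.rpow_one _
            · rw [indicator_of_notMem hx,
                ENNReal.zero_rpow_of_pos (zero_lt_one.trans_le (hp x))]
              exact zero_le
        _ = (1 + I)⁻¹ * I := lintegral_const_mul _ hSF
        _ ≤ (1 + I)⁻¹ * (1 + I) := by gcongr; exact le_add_self
        _ = 1 := ENNReal.inv_mul_cancel h1I0 h1It
    · calc b = b * ((1 + I)⁻¹ * (1 + I)) := by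
            rw [ENNReal.inv_mul_cancel h1I0 h1It, mul_one]
        _ ≤ b * ((1 + I)⁻¹ * (3 * I)) := by
            gcongr
            have h2 : 1 ≤ 2 * I := by
              calc (1 : ℝ≥0∞) = 2 * 2⁻¹ := (ENNReal.mul_inv_cancel two_ne_zero ofNat_ne_top).symm
                _ ≤ 2 * I := by gcongr
            calc 1 + I ≤ 2 * I + I := by gcongr
              _ = 3 * I := by ring
        _ = 3 * (b * (1 + I)⁻¹ * I) := by ring
        _ = 3 * ∫⁻ x, b * (1 + I)⁻¹ * S.indicator F x ∂μ := by
            rw [lintegral_const_mul _ hSF]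
        _ ≤ _ := by
            refine mul_le_mul_right (lintegral_mono fun x => ?_) _
            by_cases hx : x ∈ S ∩ G
            · have hc := Real.HolderConjugate.conjExponent (hone x hx.2)
              rw [indicator_of_mem hx, indicator_of_mem hx.1, hF, indicator_of_mem hx.2,
                toReal_conjExp (hone x hx.2)]
              have hsplit : (g x / b) ^ (p x).conjExponent
                  = (g x / b) ^ ((p x).conjExponent - 1) * (g x / b) := by
                conv_rhs => rw [← ENNReal.rpow_one (g x / b), ← ENNReal.rpow_mul, one_mul]
                rw [← ENNReal.rpow_add_of_nonneg _ _ hc.symm.sub_one_pos.le zero_le_one,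
                  sub_add_cancel]
              refine le_of_eq ?_
              calc _ = (1 + I)⁻¹ * (g x / b) ^ ((p x).conjExponent - 1) * (b * (g x / b)) := by
                    rw [hsplit]; ring
                _ = _ := by rw [ENNReal.mul_div_cancel hb0 hbt]
            · have : S.indicator F x = 0 := by
                by_cases hxS : x ∈ S
                · rw [indicator_of_mem hxS, hF, indicator_of_notMem fun hxG => hx ⟨hxS, hxG⟩]
                · rw [indicator_of_notMem hxS]
              simp [this]
  · have hTm : MeasurableSet ({x | conjExp p x = ∞} ∩ {x | 2⁻¹ < g x / b}) :=
      hm'.inter (measurableSet_lt measurable_const hgbm)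
    have hTpos : 0 < μ ({x | conjExp p x = ∞} ∩ {x | 2⁻¹ < g x / b}) := by
      rw [pos_iff_ne_zero]
      intro h0
      refine absurd (essSup_le_of_ae_le 2⁻¹ ?_) (not_le.2 hE)
      rw [Filter.EventuallyLE, ae_restrict_iff' hm']
      filter_upwards [measure_eq_zero_iff_ae_notMem.1 h0] with x hx hxE
      by_contra hcon
      exact hx ⟨hxE, not_le.1 hcon⟩
    obtain ⟨S, hSm, hST, hS, hSt⟩ := Measure.exists_subset_measure_lt_top hTm hTpos
    refine ⟨S.indicator fun _ => (μ S)⁻¹, measurable_const.indicator hSm, ?_,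
      of_integral _ ?_, ?_⟩
    · intro x
      by_cases hx : x ∈ S
      · rw [indicator_of_mem hx]
        exact ENNReal.inv_ne_top.2 hS.ne'
      · simp [indicator_of_notMem hx]
    · have heq : ∀ x, S.indicator (fun _ => (μ S)⁻¹) x ^ p x = S.indicator (fun _ => (μ S)⁻¹) x := by
        intro x
        by_cases hx : x ∈ S
        · rw [(conjExp_eq_top_iff hp x).1 (hST hx).1, ENNReal.rpow_one]
        · rw [indicator_of_notMem hx, ENNReal.zero_rpow_of_pos (zero_lt_one.trans_le (hp x))]
      simp_rw [heq]
      rw [lintegral_indicator_const hSm, ENNReal.inv_mul_cancel hS.ne' hSt.ne]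
    · calc b = 2 * (b * 2⁻¹ * ((μ S)⁻¹ * μ S)) := by
            rw [ENNReal.inv_mul_cancel hS.ne' hSt.ne, mul_one, mul_comm b, ← mul_assoc,
              ENNReal.mul_inv_cancel two_ne_zero ofNat_ne_top, one_mul]
        _ ≤ 3 * (b * 2⁻¹ * ((μ S)⁻¹ * μ S)) := by
            gcongr
            norm_num
        _ = 3 * ∫⁻ x, S.indicator (fun _ => (μ S)⁻¹ * (b * 2⁻¹)) x ∂μ := by
            rw [lintegral_indicator_const hSm]
            ring
        _ ≤ _ := by
            refine mul_le_mul_right (lintegral_mono fun x => ?_) _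
            by_cases hx : x ∈ S
            · rw [indicator_of_mem hx, indicator_of_mem hx]
              gcongr
              calc b * 2⁻¹ ≤ b * (g x / b) := by gcongr; exact (hST hx).2.le
                _ = g x := ENNReal.mul_div_cancel hb0 hbt
            · simp [indicator_of_notMem hx]

namespace Cube

theorem toSet_eq_pi {n : ℕ} (Q : Cube n) :
    Q.toSet = univ.pi fun i => Ico (Q.base i) (Q.base i + Q.side) := by
  ext x
  simp [toSet]

theorem measurableSet_toSet {n : ℕ} (Q : Cube n) : MeasurableSet Q.toSet := by
  rw [toSet_eq_pi]
  exact MeasurableSet.univ_pi fun _ => measurableSet_Ico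

theorem volume_toSet {n : ℕ} (Q : Cube n) : volume Q.toSet = Q.vol := by
  rw [toSet_eq_pi, Real.volume_pi_Ico]
  simp [vol, ENNReal.ofReal_pow Q.side_pos.le]

theorem vol_ne_zero {n : ℕ} (Q : Cube n) : Q.vol ≠ 0 := by
  simpa [vol] using pow_pos Q.side_pos n

theorem vol_ne_top {n : ℕ} (Q : Cube n) : Q.vol ≠ ∞ := ENNReal.ofReal_ne_top

end Cube

theorem vNorm_indicator_ne_zero {n : ℕ} {r : Rn n → ℝ≥0∞} (hr : Measurable r)
    (hr0 : ∀ x, r x ≠ 0) {u : Rn n → ℝ} (hu : Measurable u)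
    (hu0 : ∀ᵐ x ∂(volume : Measure (Rn n)), 0 < u x) (Q : Cube n) :
    vNorm r (Q.toSet.indicator u) ≠ 0 := by
  intro h
  have hae := ae_eq_zero_of_eNorm_eq_zero hr hr0
    (hu.indicator Q.measurableSet_toSet).abs.ennreal_ofReal h
  refine Q.vol_ne_zero ?_
  rw [← Q.volume_toSet, measure_eq_zero_iff_ae_notMem]
  filter_upwards [hae, hu0] with x hx hux hxQ
  rw [indicator_of_mem hxQ, abs_of_pos hux, ENNReal.ofReal_eq_zero] at hx
  exact hx.not_gt hux

theorem setLIntegral_le_vNorm_mul_vNorm {n : ℕ} {p w f : Rn n → ℝ} (hpm : Measurable p)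
    (hp : ∀ x, 1 ≤ p x) (hw : IsWeight w) (hf : Measurable f) (Q : Cube n)
    (h0 : vNorm (conjExp p) (Q.toSet.indicator fun x => (w x)⁻¹) ≠ 0)
    (ht : vNorm (conjExp p) (Q.toSet.indicator fun x => (w x)⁻¹) ≠ ∞) :
    ∫⁻ y in Q.toSet, ENNReal.ofReal |f y| ≤
      2 * (vNorm (ofExp p) (fun x => f x * w x) *
        vNorm (conjExp p) (Q.toSet.indicator fun x => (w x)⁻¹)) := by
  refine le_trans ?_ (lintegral_mul_le_eNorm_mul_eNorm hpm hp (hf.mul hw.1).abs.ennreal_ofReal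
    (hw.1.inv.indicator Q.measurableSet_toSet).abs.ennreal_ofReal h0 ht)
  rw [← lintegral_indicator Q.measurableSet_toSet]
  refine lintegral_mono_ae ?_
  filter_upwards [hw.2] with x hx
  by_cases hxQ : x ∈ Q.toSet
  · rw [indicator_of_mem hxQ, indicator_of_mem hxQ, ← ENNReal.ofReal_mul (abs_nonneg _), ← abs_mul,
      mul_inv_cancel_right₀ hx.ne']
  · simp [indicator_of_notMem hxQ]

theorem exists_le_setLIntegral {n : ℕ} {p w : Rn n → ℝ} (hpm : Measurable p)
    (hp : ∀ x, 1 ≤ p x) (hw : IsWeight w) (Q : Cube n) {b : ℝ≥0∞}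
    (hb : b < vNorm (conjExp p) (Q.toSet.indicator fun x => (w x)⁻¹)) :
    ∃ f : Rn n → ℝ, Measurable f ∧ vNorm (ofExp p) (fun x => f x * w x) ≤ 1 ∧
      b ≤ 3 * ∫⁻ y in Q.toSet, ENNReal.ofReal |f y| := by
  have hgm := (hw.1.inv.indicator Q.measurableSet_toSet).abs.ennreal_ofReal
  obtain ⟨h, hm, hfin, hn, hle⟩ :=
    exists_le_lintegral_mul hpm hp hgm (fun x => ENNReal.ofReal_ne_top) hb
  have habs : ∀ x, ENNReal.ofReal
      |(h x * ENNReal.ofReal |Q.toSet.indicator (fun x => (w x)⁻¹) x|).toReal| =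
      h x * ENNReal.ofReal |Q.toSet.indicator (fun x => (w x)⁻¹) x| := fun x => by
    rw [abs_of_nonneg toReal_nonneg,
      ENNReal.ofReal_toReal (ENNReal.mul_ne_top (hfin x) ENNReal.ofReal_ne_top)]
  refine ⟨fun x => (h x * ENNReal.ofReal |Q.toSet.indicator (fun x => (w x)⁻¹) x|).toReal,
    (hm.mul hgm).ennreal_toReal, (eNorm_mono_ae ?_).trans hn, hle.trans_eq ?_⟩
  · filter_upwards [hw.2] with x hx
    rw [abs_mul, ENNReal.ofReal_mul (abs_nonneg _), habs, mul_assoc,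
      ← ENNReal.ofReal_mul (abs_nonneg _), ← abs_mul]
    refine mul_le_of_le_one_right' ?_
    by_cases hxQ : x ∈ Q.toSet
    · simp [indicator_of_mem hxQ, inv_mul_cancel₀ hx.ne']
    · simp [indicator_of_notMem hxQ]
  · simp only [habs]
    rw [← lintegral_indicator Q.measurableSet_toSet]
    congr 2
    ext x
    by_cases hxQ : x ∈ Q.toSet
    · simp [indicator_of_mem hxQ]
    · simp [indicator_of_notMem hxQ]

/-- `(w₁,w₂,w) ∈ A_{p⃗(·)}` iff the bilinear averaging operators `A_Q` are
uniformly bounded; no log-Hölder continuity is assumed. -/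
theorem statement2 {n : ℕ} (p₁ p₂ p w₁ w₂ w : Rn n → ℝ)
    (hp₁m : Measurable p₁) (hp₂m : Measurable p₂)
    (hp₁1 : ∀ x, 1 ≤ p₁ x) (hp₂1 : ∀ x, 1 ≤ p₂ x)
    (hp : ∀ x, 1 / p x = 1 / p₁ x + 1 / p₂ x)
    (hw₁ : IsWeight w₁) (hw₂ : IsWeight w₂)
    (hw : ∀ x, w x = w₁ x * w₂ x) :
    ApVec p₁ p₂ p w₁ w₂ w ↔
      ∃ C : ℝ≥0∞, C ≠ ∞ ∧ ∀ (Q : Cube n) (f₁ f₂ : Rn n → ℝ),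
        Measurable f₁ → Measurable f₂ →
        eNorm (ofExp p) volume (fun x => avgOp Q f₁ f₂ x * ENNReal.ofReal (w x)) ≤
          C * vNorm (ofExp p₁) (fun x => f₁ x * w₁ x) *
            vNorm (ofExp p₂) (fun x => f₂ x * w₂ x) := by
  have hp_eq : ∀ x, p x = (1 / p₁ x + 1 / p₂ x)⁻¹ := fun x => by
    rw [← hp, one_div, inv_inv]
  have hpm : Measurable p := by
    rw [funext hp_eq]
    fun_prop
  have hppos : ∀ x, 0 < p x := fun x => by
    have h1 := zero_lt_one.trans_le (hp₁1 x)
    have h2 := zero_lt_one.trans_le (hp₂1 x)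
    rw [hp_eq]
    positivity
  have hwm : Measurable w := by
    rw [funext hw]
    exact hw₁.1.mul hw₂.1
  have hwpos : ∀ᵐ x ∂(volume : Measure (Rn n)), 0 < w x := by
    filter_upwards [hw₁.2, hw₂.2] with x h1 h2
    rw [hw]
    exact mul_pos h1 h2
  have hinv : ∀ {v : Rn n → ℝ}, IsWeight v →
      ∀ᵐ x ∂(volume : Measure (Rn n)), 0 < (v x)⁻¹ := fun hv => by
    filter_upwards [hv.2] with x hx using inv_pos.2 hx
  have havg : ∀ (Q : Cube n) (f₁ f₂ : Rn n → ℝ),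
      (fun x => avgOp Q f₁ f₂ x * ENNReal.ofReal (w x)) =ᵐ[volume] fun x =>
        ((Q.vol⁻¹ * ∫⁻ y in Q.toSet, ENNReal.ofReal |f₁ y|) *
          (Q.vol⁻¹ * ∫⁻ y in Q.toSet, ENNReal.ofReal |f₂ y|)) *
          ENNReal.ofReal |Q.toSet.indicator w x| := fun Q f₁ f₂ => by
    filter_upwards [hwpos] with x hx
    by_cases hxQ : x ∈ Q.toSet
    · simp only [avgOp, indicator_of_mem hxQ, abs_of_pos hx]
    · simp [avgOp, indicator_of_notMem hxQ]
  constructor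
  · rintro ⟨C, hC, hA⟩
    refine ⟨4 * C, ENNReal.mul_ne_top ofNat_ne_top hC, fun Q f₁ f₂ hf₁ hf₂ => ?_⟩
    have hQ := hA Q
    have hA0 := vNorm_indicator_ne_zero (r := ofExp p) hpm.ennreal_ofReal
      (fun x => by simpa [ofExp] using hppos x) hwm hwpos Q
    have hB₁0 := vNorm_indicator_ne_zero (measurable_conjExp hp₁m) (conjExp_ne_zero hp₁1)
      hw₁.1.inv (hinv hw₁) Q
    have hB₂0 := vNorm_indicator_ne_zero (measurable_conjExp hp₂m) (conjExp_ne_zero hp₂1)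
      hw₂.1.inv (hinv hw₂) Q
    have hfin₁ := fun h0 ht => setLIntegral_le_vNorm_mul_vNorm hp₁m hp₁1 hw₁ hf₁ Q h0 ht
    have hfin₂ := fun h0 ht => setLIntegral_le_vNorm_mul_vNorm hp₂m hp₂1 hw₂ hf₂ Q h0 ht
    have hscale := eNorm_const_mul_le_of_ne (ofExp p) volume
      (fun x => ENNReal.ofReal |Q.toSet.indicator w x|)
      ((Q.vol⁻¹ * ∫⁻ y in Q.toSet, ENNReal.ofReal |f₁ y|) *
          (Q.vol⁻¹ * ∫⁻ y in Q.toSet, ENNReal.ofReal |f₂ y|)) hA0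
    have hv0 : Q.vol⁻¹ ^ 2 ≠ 0 := pow_ne_zero 2 (ENNReal.inv_ne_zero.2 Q.vol_ne_top)
    simp only [Pi.inv_def] at hB₁0 hB₂0
    change vNorm (ofExp p) (Q.toSet.indicator w) ≠ ∞ →
      _ ≤ _ * vNorm (ofExp p) (Q.toSet.indicator w) at hscale
    set A := vNorm (ofExp p) (Q.toSet.indicator w)
    set B₁ := vNorm (conjExp p₁) (Q.toSet.indicator fun x => (w₁ x)⁻¹)
    set B₂ := vNorm (conjExp p₂) (Q.toSet.indicator fun x => (w₂ x)⁻¹)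
    have hlt := hQ.trans_lt hC.lt_top
    have hAt : A ≠ ∞ := by
      rintro h
      simp [h, ENNReal.mul_top hv0, ENNReal.top_mul hB₁0, ENNReal.top_mul hB₂0] at hlt
    have hB₁t : B₁ ≠ ∞ := by
      rintro h
      simp [h, ENNReal.mul_top (mul_ne_zero hv0 hA0), ENNReal.top_mul hB₂0] at hlt
    have hB₂t : B₂ ≠ ∞ := by
      rintro h
      simp [h, ENNReal.mul_top (mul_ne_zero (mul_ne_zero hv0 hA0) hB₁0)] at hlt
    calc _ ≤ _ := eNorm_mono_ae (havg Q f₁ f₂).le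
      _ ≤ _ := hscale hAt
      _ ≤ ((Q.vol⁻¹ * (2 * (vNorm (ofExp p₁) (fun x => f₁ x * w₁ x) * B₁))) *
          (Q.vol⁻¹ * (2 * (vNorm (ofExp p₂) (fun x => f₂ x * w₂ x) * B₂)))) * A := by
        gcongr
        · exact hfin₁ hB₁0 hB₁t
        · exact hfin₂ hB₂0 hB₂t
      _ = 4 * (Q.vol⁻¹ ^ 2 * A * B₁ * B₂) * vNorm (ofExp p₁) (fun x => f₁ x * w₁ x) *
          vNorm (ofExp p₂) (fun x => f₂ x * w₂ x) := by ring
      _ ≤ _ := by gcongr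
  · rintro ⟨C, hC, hbd⟩
    refine ⟨9 * C, ENNReal.mul_ne_top ofNat_ne_top hC, fun Q => ?_⟩
    have htest : ∀ b₁ < vNorm (conjExp p₁) (Q.toSet.indicator fun x => (w₁ x)⁻¹),
        ∀ b₂ < vNorm (conjExp p₂) (Q.toSet.indicator fun x => (w₂ x)⁻¹),
        b₁ * b₂ * (Q.vol⁻¹ ^ 2 * vNorm (ofExp p) (Q.toSet.indicator w)) ≤ 9 * C := by
      intro b₁ hb₁ b₂ hb₂
      rcases eq_or_ne b₁ 0 with rfl | hb₁0
      · simp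
      rcases eq_or_ne b₂ 0 with rfl | hb₂0
      · simp
      obtain ⟨f₁, hf₁, hn₁, hle₁⟩ := exists_le_setLIntegral hp₁m hp₁1 hw₁ Q hb₁
      obtain ⟨f₂, hf₂, hn₂, hle₂⟩ := exists_le_setLIntegral hp₂m hp₂1 hw₂ Q hb₂
      have hc0 : b₁ * b₂ * Q.vol⁻¹ ^ 2 ≠ 0 := mul_ne_zero (mul_ne_zero hb₁0 hb₂0)
        (pow_ne_zero 2 (ENNReal.inv_ne_zero.2 Q.vol_ne_top))
      have hct : b₁ * b₂ * Q.vol⁻¹ ^ 2 ≠ ∞ := ENNReal.mul_ne_top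
        (ENNReal.mul_ne_top hb₁.ne_top hb₂.ne_top)
        (ENNReal.pow_ne_top (ENNReal.inv_ne_top.2 Q.vol_ne_zero))
      rw [← mul_assoc]
      calc _ ≤ _ := le_eNorm_const_mul _ _ _ hc0 hct
        _ ≤ eNorm (ofExp p) volume
            (fun x => 9 * (avgOp Q f₁ f₂ x * ENNReal.ofReal (w x))) := by
          refine eNorm_mono_ae ?_
          filter_upwards [havg Q f₁ f₂] with x hx
          rw [hx, ← mul_assoc]
          refine mul_le_mul_left ?_ _
          calc b₁ * b₂ * Q.vol⁻¹ ^ 2 ≤ (3 * ∫⁻ y in Q.toSet, ENNReal.ofReal |f₁ y|) *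
              (3 * ∫⁻ y in Q.toSet, ENNReal.ofReal |f₂ y|) * Q.vol⁻¹ ^ 2 := by gcongr
            _ = _ := by ring
        _ ≤ 9 * eNorm (ofExp p) volume
            (fun x => avgOp Q f₁ f₂ x * ENNReal.ofReal (w x)) :=
          eNorm_const_mul_le _ _ _ (by norm_num) ofNat_ne_top
        _ ≤ 9 * (C * 1 * 1) := by
          gcongr
          refine (hbd Q f₁ f₂ hf₁ hf₂).trans ?_
          gcongr
        _ = 9 * C := by ring
    calc _ = vNorm (conjExp p₁) (Q.toSet.indicator fun x => (w₁ x)⁻¹) *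
          (vNorm (conjExp p₂) (Q.toSet.indicator fun x => (w₂ x)⁻¹) *
            (Q.vol⁻¹ ^ 2 * vNorm (ofExp p) (Q.toSet.indicator w))) := by ring
      _ ≤ 9 * C := by
        refine ENNReal.mul_le_of_forall_lt fun b₁ hb₁ d hd => ?_
        refine (mul_le_mul_right hd.le b₁).trans ?_
        rw [mul_left_comm]
        refine ENNReal.mul_le_of_forall_lt fun b₂ hb₂ e he => ?_
        refine (mul_le_mul_right he.le b₂).trans ?_
        rw [← mul_assoc, mul_comm b₂]
        exact htest b₁ hb₁ b₂ hb₂
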